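/- arXiv:2507.21237 — 2 statements merged into one kernel-verified Lean document; each statement's English description precedes it below -/
import Mathlib

section
/- Let r ≥ 2 be an integer. For every pair of integers (x, y) ≠ (0, 0), one has |2r²·x + (2r−1)·y| + |y| ≥ 2r. Equivalently, every non-zero vector of the sublattice ℤ·(2r², 0) ⊕ ℤ·(2r−1, −1) of ℤ² has Manhattan norm at least 2r. -/
/-- A multiple of `m` that is smaller than `m` in absolute value vanishes. -/
lemma eq_zero_of_abs_mul_lt {m k : ℤ} (h : |m * k| < m) : k = 0 := by
  have hm : 0 < m := (abs_nonneg _).trans_lt h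
  have := Int.eq_zero_of_abs_lt_dvd (dvd_mul_right m k) h
  exact (mul_eq_zero.mp this).resolve_left hm.ne'

/-- With `a = 2r² x + (2r−1) y`, the sum `a + y` is `2r (r x + y)`, and once `r x + y = 0`,
the difference `a - y` is `2r x`. -/
lemma two_mul_le_abs_add_abs (r x y : ℤ) (hxy : ¬(x = 0 ∧ y = 0)) :
    2 * r ≤ |2 * r ^ 2 * x + (2 * r - 1) * y| + |y| := by
  by_contra! h
  have hsum : r * x + y = 0 := by
    refine eq_zero_of_abs_mul_lt (m := 2 * r) (lt_of_le_of_lt ?_ h)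
    refine le_trans (le_of_eq ?_) (abs_add_le _ _)
    ring_nf
  obtain rfl : y = -(r * x) := by linarith
  have hx : x = 0 := by
    refine eq_zero_of_abs_mul_lt (m := 2 * r) (lt_of_le_of_lt ?_ h)
    refine le_trans (le_of_eq ?_) (abs_sub _ _)
    ring_nf
  exact hxy ⟨hx, by simp [hx]⟩

/-- For `r ≥ 2`, every non-zero integer pair `(x, y)` satisfies
`|2r² x + (2r−1) y| + |y| ≥ 2r`; equivalently, every non-zero vector of the sublattice
`ℤ·(2r², 0) ⊕ ℤ·(2r−1, −1)` of `ℤ²` has Manhattan norm at least `2r`. -/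
theorem lattice_manhattan_bound_even (r : ℤ) (hr : 2 ≤ r) :
    (∀ x y : ℤ, ¬(x = 0 ∧ y = 0) → 2 * r ≤ |2 * r ^ 2 * x + (2 * r - 1) * y| + |y|) ∧
    (∀ v : ℤ × ℤ,
      (∃ x y : ℤ, v = x • ((2 * r ^ 2, 0) : ℤ × ℤ) + y • ((2 * r - 1, -1) : ℤ × ℤ)) →
      v ≠ 0 → 2 * r ≤ |v.1| + |v.2|) := by
  refine ⟨fun x y => two_mul_le_abs_add_abs r x y, ?_⟩
  rintro _ ⟨x, y, rfl⟩ hv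
  have hxy : ¬(x = 0 ∧ y = 0) := by
    rintro ⟨rfl, rfl⟩
    simp at hv
  simpa [mul_comm] using two_mul_le_abs_add_abs r x y hxy
end

section
/- Let t ≥ 2 be an integer. For every pair of integers (x, y) ≠ (0, 0), one has |(t² + (t+1)²)·x + (2t+1)·y| + |y| ≥ 2t + 1. Equivalently, every non-zero vector of the sublattice ℤ·(t² + (t+1)², 0) ⊕ ℤ·(2t+1, −1) of ℤ² has Manhattan norm at least 2t + 1. -/
/-- The Manhattan norm of a non-zero vector `a • (-(t + 1), t) + b • (t, t + 1)` is at least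
`2 * t + 1`. -/
theorem two_mul_add_one_le_abs_add_abs_of_square_lattice {t a b : ℤ} (ht : 0 ≤ t)
    (hab : ¬(a = 0 ∧ b = 0)) :
    2 * t + 1 ≤ |-(t + 1) * a + t * b| + |t * a + (t + 1) * b| := by
  by_cases h : a ^ 2 + b ^ 2 < 2
  · have ha : -1 ≤ a ∧ a ≤ 1 := by constructor <;> nlinarith [sq_nonneg b]
    have hb : -1 ≤ b ∧ b ≤ 1 := by constructor <;> nlinarith [sq_nonneg a]
    obtain ⟨ha₁, ha₂⟩ := ha
    obtain ⟨hb₁, hb₂⟩ := hb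
    interval_cases a <;> interval_cases b <;> grind
  · set u := -(t + 1) * a + t * b with hu
    set v := t * a + (t + 1) * b with hv
    have huv : u ^ 2 + v ^ 2 = (t ^ 2 + (t + 1) ^ 2) * (a ^ 2 + b ^ 2) := by
      rw [hu, hv]; ring
    have hn : 0 ≤ t ^ 2 + (t + 1) ^ 2 := by positivity
    have hsq : (t ^ 2 + (t + 1) ^ 2) * 2 ≤ u ^ 2 + v ^ 2 :=
      huv ▸ mul_le_mul_of_nonneg_left (not_lt.mp h) hn
    refine abs_le_of_sq_le_sq' ?_ (by positivity) |>.2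
    nlinarith [sq_abs u, sq_abs v, mul_nonneg (abs_nonneg u) (abs_nonneg v)]

/-- For `t ≥ 2`, every non-zero integer pair `(x, y)` satisfies
`|(t² + (t+1)²) x + (2t+1) y| + |y| ≥ 2t + 1`; equivalently, every non-zero vector of
the sublattice `ℤ·(t² + (t+1)², 0) ⊕ ℤ·(2t+1, −1)` of `ℤ²` has Manhattan norm at
least `2t + 1`. -/
theorem lattice_manhattan_bound_odd (t : ℤ) (ht : 2 ≤ t) :
    (∀ x y : ℤ, ¬(x = 0 ∧ y = 0) →
      2 * t + 1 ≤ |(t ^ 2 + (t + 1) ^ 2) * x + (2 * t + 1) * y| + |y|) ∧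
    (∀ v : ℤ × ℤ,
      (∃ x y : ℤ, v = x • ((t ^ 2 + (t + 1) ^ 2, 0) : ℤ × ℤ) + y • ((2 * t + 1, -1) : ℤ × ℤ)) →
      v ≠ 0 → 2 * t + 1 ≤ |v.1| + |v.2|) := by
  have bound (x y : ℤ) (hxy : ¬(x = 0 ∧ y = 0)) :
      2 * t + 1 ≤ |(t ^ 2 + (t + 1) ^ 2) * x + (2 * t + 1) * y| + |y| := by
    have hab : ¬(-y - (t + 1) * x = 0 ∧ t * x + y = 0) := by
      rintro ⟨ha, hb⟩
      have hx : x = 0 := by linear_combination -ha - hb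
      exact hxy ⟨hx, by simpa [hx] using hb⟩
    convert two_mul_add_one_le_abs_add_abs_of_square_lattice (by lia : 0 ≤ t) hab using 3 <;> ring
  refine ⟨bound, ?_⟩
  rintro v ⟨x, y, rfl⟩ hv
  have hxy : ¬(x = 0 ∧ y = 0) := by
    rintro ⟨rfl, rfl⟩
    simp at hv
  simpa [mul_comm] using bound x y hxy
end
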